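/- Let h > 0, 1 < p < ∞, and let f : ℝ → ℂ be a Schwartz function with supp(f̂) ⊆ [-π/h, π/h]. Then ∫_ℝ |f(x)|^p dx ≃ h ∑_{n∈ℤ} |f(hn)|^p, with implicit constants depending only on p (Plancherel–Pólya inequality in dimension one). -/

import Mathlib

open MeasureTheory Complex

namespace PP

/-- discrete convolution with kernel `k` is bounded on `ℓ^p` with constant `C` (p-th power form). -/
def KB (p : ℝ) (k : ℤ → ℂ) (C : ℝ) : Prop :=
  ∀ (S F : Finset ℤ) (a : ℤ → ℂ),
    ∑ m ∈ S, ‖∑ n ∈ F, a n * k (m - n)‖ ^ p ≤ C * ∑ n ∈ F, ‖a n‖ ^ p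

noncomputable def w (j : ℤ) : ℝ := 1 / (1 + (j : ℝ) ^ 2)

lemma w_pos (j : ℤ) : 0 < w j := by unfold w; positivity

lemma w_neg (j : ℤ) : w (-j) = w j := by simp [w]

lemma w_summable : Summable w := by
  have h1 : Summable (fun n : ℕ => 1 / (1 + (n : ℝ) ^ 2)) := by
    refine Summable.of_nonneg_of_le (fun n => by positivity) (fun n => ?_)
      (((Real.summable_one_div_nat_pow (p := 2)).2 one_lt_two |> (summable_nat_add_iff 1).2).mul_left 2)
    rw [mul_one_div, div_le_div_iff₀ (by positivity) (by positivity)]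
    push_cast
    nlinarith [sq_nonneg ((n : ℝ) - 1)]
  rw [summable_int_iff_summable_nat_and_neg]
  constructor
  · simpa [w] using h1
  · simpa [w] using h1

noncomputable def W : ℝ := ∑' j, w j

lemma W_pos : 0 < W := w_summable.tsum_pos (fun j => (w_pos j).le) 0 (w_pos 0)

lemma sum_w_le (F : Finset ℤ) (m : ℤ) : ∑ n ∈ F, w (m - n) ≤ W := by
  have h : Summable (fun n : ℤ => w (m - n)) := (Equiv.subLeft m).summable_iff.2 w_summable
  have h2 : ∑' n : ℤ, w (m - n) = W := (Equiv.subLeft m).tsum_eq w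
  rw [← h2]
  exact h.sum_le_tsum F (fun j _ => (w_pos _).le)

lemma sum_w_le' (F : Finset ℤ) (m : ℤ) : ∑ n ∈ F, w (n - m) ≤ W := by
  refine le_trans (le_of_eq ?_) (sum_w_le F m)
  refine Finset.sum_congr rfl fun n _ => ?_
  rw [← w_neg]; congr 1; ring

lemma add_rpow_le {p x y : ℝ} (hp : 0 < p) (hx : 0 ≤ x) (hy : 0 ≤ y) :
    (x + y) ^ p ≤ 2 ^ p * (x ^ p + y ^ p) := by
  have hxp := Real.rpow_nonneg hx p
  have hyp := Real.rpow_nonneg hy p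
  rcases le_total x y with h | h
  · calc (x + y) ^ p ≤ (2 * y) ^ p := Real.rpow_le_rpow (by positivity) (by linarith) hp.le
      _ = 2 ^ p * y ^ p := Real.mul_rpow (by norm_num) hy
      _ ≤ _ := by gcongr; linarith
  · calc (x + y) ^ p ≤ (2 * x) ^ p := Real.rpow_le_rpow (by positivity) (by linarith) hp.le
      _ = 2 ^ p * x ^ p := Real.mul_rpow (by norm_num) hx
      _ ≤ _ := by gcongr; linarith

/-- Young's inequality with the weight `w`. -/
lemma young {p : ℝ} (hp : 1 < p) (S F : Finset ℤ) (a : ℤ → ℝ) (ha : ∀ n, 0 ≤ a n) :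
    ∑ m ∈ S, (∑ n ∈ F, w (m - n) * a n) ^ p ≤ W ^ p * ∑ n ∈ F, a n ^ p := by
  have hp0 : 0 < p := by linarith
  have hW := W_pos
  have key : ∀ m, (∑ n ∈ F, w (m - n) * a n) ^ p ≤
      W ^ (p - 1) * ∑ n ∈ F, w (m - n) * a n ^ p := by
    intro m
    have h := Real.inner_le_weight_mul_Lp_of_nonneg F hp.le (fun n => w (m - n)) a
      (fun n => (w_pos _).le) ha
    have h0 : 0 ≤ ∑ n ∈ F, w (m - n) := Finset.sum_nonneg fun n _ => (w_pos _).le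
    have h1 : 0 ≤ ∑ n ∈ F, w (m - n) * a n ^ p :=
      Finset.sum_nonneg fun n _ => mul_nonneg (w_pos _).le (Real.rpow_nonneg (ha n) _)
    calc _ ≤ ((∑ i ∈ F, w (m - i)) ^ (1 - p⁻¹) * (∑ i ∈ F, w (m - i) * a i ^ p) ^ p⁻¹) ^ p :=
          Real.rpow_le_rpow (Finset.sum_nonneg fun n _ => mul_nonneg (w_pos _).le (ha n)) h hp0.le
      _ = (∑ i ∈ F, w (m - i)) ^ (p - 1) * (∑ i ∈ F, w (m - i) * a i ^ p) := by
          rw [Real.mul_rpow (Real.rpow_nonneg h0 _) (Real.rpow_nonneg h1 _),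
            ← Real.rpow_mul h0, ← Real.rpow_mul h1, inv_mul_cancel₀ hp0.ne', Real.rpow_one,
            sub_mul, inv_mul_cancel₀ hp0.ne', one_mul]
      _ ≤ _ := by
          gcongr
          exact sum_w_le F m
  calc _ ≤ ∑ m ∈ S, W ^ (p - 1) * ∑ n ∈ F, w (m - n) * a n ^ p :=
        Finset.sum_le_sum fun m _ => key m
    _ = W ^ (p - 1) * ∑ n ∈ F, (∑ m ∈ S, w (m - n)) * a n ^ p := by
        rw [← Finset.mul_sum, Finset.sum_comm]
        simp_rw [Finset.sum_mul]
    _ ≤ W ^ (p - 1) * ∑ n ∈ F, W * a n ^ p := by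
        gcongr with n hn
        · exact Real.rpow_nonneg (ha n) _
        · exact sum_w_le' S n
    _ = _ := by
        rw [← Finset.mul_sum, ← mul_assoc]
        congr 1
        nth_rewrite 2 [← Real.rpow_one W]
        rw [← Real.rpow_add hW]; congr 1; ring

lemma KB_young {p : ℝ} (hp : 1 < p) {k : ℤ → ℂ} {M : ℝ} (hM : 0 ≤ M)
    (hk : ∀ j, ‖k j‖ ≤ M * w j) : KB p k (M ^ p * W ^ p) := by
  intro S F a
  have hp0 : 0 < p := by linarith
  calc _ ≤ ∑ m ∈ S, (M * ∑ n ∈ F, w (m - n) * ‖a n‖) ^ p := by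
        refine Finset.sum_le_sum fun m _ => Real.rpow_le_rpow (norm_nonneg _) ?_ hp0.le
        refine (norm_sum_le _ _).trans ?_
        rw [Finset.mul_sum]
        refine Finset.sum_le_sum fun n _ => ?_
        rw [norm_mul]
        nlinarith [hk (m - n), norm_nonneg (a n)]
    _ = M ^ p * ∑ m ∈ S, (∑ n ∈ F, w (m - n) * ‖a n‖) ^ p := by
        rw [Finset.mul_sum]
        refine Finset.sum_congr rfl fun m _ => ?_
        rw [Real.mul_rpow hM (Finset.sum_nonneg fun n _ => mul_nonneg (w_pos _).le (norm_nonneg _))]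
    _ ≤ _ := by
        rw [mul_assoc]
        gcongr
        exact young hp S F _ (fun n => norm_nonneg _)

lemma KB.add {p : ℝ} (hp : 1 < p) {k l : ℤ → ℂ} {C D : ℝ} (hk : KB p k C) (hl : KB p l D) :
    KB p (fun j => k j + l j) (2 ^ p * (C + D)) := by
  intro S F a
  have hp0 : 0 < p := by linarith
  calc _ ≤ ∑ m ∈ S, 2 ^ p * (‖∑ n ∈ F, a n * k (m - n)‖ ^ p + ‖∑ n ∈ F, a n * l (m - n)‖ ^ p) := by
        refine Finset.sum_le_sum fun m _ => ?_
        refine le_trans ?_ (add_rpow_le hp0 (norm_nonneg _) (norm_nonneg _))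
        refine Real.rpow_le_rpow (norm_nonneg _) ?_ hp0.le
        simp_rw [mul_add, Finset.sum_add_distrib]
        exact norm_add_le _ _
    _ ≤ _ := by
        rw [← Finset.mul_sum, Finset.sum_add_distrib, mul_assoc, add_mul]
        gcongr
        · exact hk S F a
        · exact hl S F a

/-- twist by a bounded constant and by `(-1)^j` -/
lemma KB.twist {p : ℝ} (hp : 1 < p) {k : ℤ → ℂ} {C : ℝ} (hC : 0 ≤ C) (hk : KB p k C) (c : ℂ)
    (hc : ‖c‖ ≤ 1) : KB p (fun j => (-1) ^ j * c * k j) C := by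
  intro S F a
  have hp0 : 0 < p := by linarith
  have h := hk S F (fun n => (-1) ^ n * c * a n)
  refine le_trans (le_of_eq ?_) (h.trans ?_)
  · refine Finset.sum_congr rfl fun m _ => ?_
    congr 1
    have : ∑ n ∈ F, a n * ((-1) ^ (m - n) * c * k (m - n)) =
        (-1) ^ m * ∑ n ∈ F, (-1) ^ n * c * a n * k (m - n) := by
      rw [Finset.mul_sum]
      refine Finset.sum_congr rfl fun n _ => ?_
      have h1 : ((-1 : ℂ)) ^ (m - n) = (-1) ^ m * (-1) ^ n := by
        rw [zpow_sub₀ (by norm_num), div_eq_mul_inv]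
        congr 1
        rw [← inv_zpow]; norm_num
      rw [h1]; ring
    rw [this, norm_mul, norm_zpow]
    simp
  · refine mul_le_mul_of_nonneg_left (Finset.sum_le_sum fun n _ => ?_) hC
    refine Real.rpow_le_rpow (norm_nonneg _) ?_ hp0.le
    rw [norm_mul, norm_mul, norm_zpow]
    simp only [norm_neg, norm_one, one_zpow, one_mul]
    nlinarith [norm_nonneg (a n)]

/-- pointwise inequality behind M. Riesz' theorem -/
lemma pointwise {p : ℝ} (hp : 1 < p) (hp2 : p ≤ 2) : ∃ A B : ℝ, 0 ≤ A ∧ 0 ≤ B ∧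
    ∀ z : ℂ, 0 < z.re → ‖z‖ ^ p ≤ A * z.re ^ p - B * (z ^ (p : ℂ)).re := by
  have hp0 : 0 < p := by linarith
  have hpi := Real.pi_pos
  set θ := (Real.pi / (2 * p) + Real.pi / 2) / 2 with hθ
  have hlt : Real.pi / (2 * p) < Real.pi / 2 := by
    apply div_lt_div_of_pos_left hpi (by norm_num); linarith
  have hq : 0 < Real.pi / (2 * p) := by positivity
  have h1 : θ < Real.pi / 2 := by linarith
  have h2 : Real.pi / (2 * p) < θ := by linarith
  have h3 : Real.pi / 2 < p * θ := by
    have : p * (Real.pi / (2 * p)) = Real.pi / 2 := by field_simp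
    rw [← this]; gcongr
  have h4 : p * θ < Real.pi := by nlinarith
  set δ := -Real.cos (p * θ) with hδ
  have hδ0 : 0 < δ := by
    rw [hδ, neg_pos]; exact Real.cos_neg_of_pi_div_two_lt_of_lt h3 (by linarith)
  have hc0 : 0 < Real.cos θ := Real.cos_pos_of_mem_Ioo ⟨by linarith, h1⟩
  refine ⟨(1 + 1 / δ) / Real.cos θ ^ p, 1 / δ, by positivity, by positivity, fun z hz => ?_⟩
  have hz0 : z ≠ 0 := by rintro rfl; simp at hz
  have harg : |z.arg| < Real.pi / 2 := by
    rw [Complex.abs_arg_lt_pi_div_two_iff]; exact Or.inl hz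
  have hre : z.re = ‖z‖ * Real.cos z.arg := by rw [Complex.norm_mul_cos_arg]
  have hr : 0 < ‖z‖ := norm_pos_iff.2 hz0
  have hcz : 0 ≤ Real.cos z.arg := by
    by_contra hh; push Not at hh; nlinarith
  rw [Complex.cpow_ofReal_re]
  have hre' : z.re ^ p = ‖z‖ ^ p * Real.cos z.arg ^ p := by
    rw [hre, Real.mul_rpow hr.le hcz]
  rw [hre']
  have hrp : 0 < ‖z‖ ^ p := by positivity
  suffices h : 1 ≤ (1 + 1 / δ) / Real.cos θ ^ p * Real.cos z.arg ^ p
      - 1 / δ * Real.cos (z.arg * p) by nlinarith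
  have hcp : Real.cos (z.arg * p) = Real.cos (p * |z.arg|) := by
    rw [← Real.cos_abs (z.arg * p), abs_mul, abs_of_pos hp0, mul_comm]
  rcases le_total θ |z.arg| with h | h
  · have : Real.cos (z.arg * p) ≤ -δ := by
      rw [hcp, hδ, neg_neg]
      apply Real.cos_le_cos_of_nonneg_of_le_pi (by positivity) _ (by gcongr)
      nlinarith
    have h5 : 1 / δ * Real.cos (z.arg * p) ≤ -1 := by
      calc _ ≤ 1 / δ * (-δ) := by gcongr
        _ = -1 := by field_simp
    have : 0 ≤ (1 + 1 / δ) / Real.cos θ ^ p * Real.cos z.arg ^ p := by positivity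
    linarith
  · have hcos : Real.cos θ ≤ Real.cos z.arg := by
      rw [← Real.cos_abs z.arg]
      exact Real.cos_le_cos_of_nonneg_of_le_pi (abs_nonneg _) (by linarith) h
    have : 1 + 1 / δ ≤ (1 + 1 / δ) / Real.cos θ ^ p * Real.cos z.arg ^ p := by
      rw [div_mul_eq_mul_div, le_div_iff₀ (by positivity)]
      gcongr
    have h6 : 1 / δ * Real.cos (z.arg * p) ≤ 1 / δ * 1 := by
      gcongr; exact Real.cos_le_one _
    linarith

noncomputable def Fz (F : Finset ℤ) (a : ℤ → ℝ) (z : ℂ) : ℂ := ∑ n ∈ F, (a n : ℂ) * (I / (z - n))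

noncomputable def ker (j : ℤ) : ℂ := 1 / ((j : ℂ) + I)

lemma I_div_re (z : ℂ) : (I / z).re = z.im / normSq z := by
  simp [Complex.div_re]

lemma Fz_re (F : Finset ℤ) (a : ℤ → ℝ) (z : ℂ) :
    (Fz F a z).re = ∑ n ∈ F, a n * (z.im / normSq (z - n)) := by
  unfold Fz
  rw [Complex.re_sum]
  refine Finset.sum_congr rfl fun n _ => ?_
  rw [Complex.re_ofReal_mul, I_div_re]; simp

lemma sub_int_ne {z : ℂ} (hz : 0 < z.im) (n : ℤ) : z - n ≠ 0 := by
  intro h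
  have := congrArg Complex.im h
  simp at this; linarith

lemma Fz_re_pos {F : Finset ℤ} {a : ℤ → ℝ} (ha : ∀ n, 0 ≤ a n) (hex : ∃ n ∈ F, 0 < a n)
    {z : ℂ} (hz : 0 < z.im) : 0 < (Fz F a z).re := by
  rw [Fz_re]
  obtain ⟨n, hn, hpos⟩ := hex
  have hq : ∀ n : ℤ, 0 < z.im / normSq (z - n) := fun n =>
    div_pos hz (Complex.normSq_pos.2 (sub_int_ne hz n))
  exact Finset.sum_pos' (fun n _ => mul_nonneg (ha n) (hq n).le) ⟨n, hn, mul_pos hpos (hq n)⟩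

lemma Fz_cpow_diff {F : Finset ℤ} {a : ℤ → ℝ} (ha : ∀ n, 0 ≤ a n) (hex : ∃ n ∈ F, 0 < a n)
    (p : ℝ) {z : ℂ} (hz : 0 < z.im) : DifferentiableAt ℂ (fun z => Fz F a z ^ (p : ℂ)) z := by
  have h : DifferentiableAt ℂ (Fz F a) z := by
    unfold Fz
    refine DifferentiableAt.fun_sum fun n _ => ?_
    refine DifferentiableAt.const_mul ?_ _
    exact DifferentiableAt.div (by fun_prop) (by fun_prop) (sub_int_ne hz n)
  exact h.cpow_const (Or.inl (Fz_re_pos ha hex hz))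

lemma Fz_bound (F : Finset ℤ) {a : ℤ → ℝ} (ha : ∀ n, 0 ≤ a n) {R : ℝ}
    (hR : 2 * ∑ n ∈ F, |(n : ℝ)| + 1 ≤ R) {z : ℂ} (hz : R ≤ ‖z‖) :
    ‖Fz F a z‖ ≤ 2 * (∑ n ∈ F, a n) / R := by
  have hs : 0 ≤ ∑ n ∈ F, |(n : ℝ)| := Finset.sum_nonneg fun n _ => abs_nonneg _
  have hR0 : 0 < R := by linarith
  unfold Fz
  refine (norm_sum_le _ _).trans ?_
  rw [Finset.mul_sum, Finset.sum_div]
  refine Finset.sum_le_sum fun n hn => ?_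
  have h1 : |(n : ℝ)| ≤ ∑ n ∈ F, |(n : ℝ)| :=
    Finset.single_le_sum (f := fun n : ℤ => |(n : ℝ)|) (fun n _ => abs_nonneg _) hn
  have h2 : R / 2 ≤ ‖z - n‖ := by
    have := norm_sub_norm_le z (n : ℂ)
    rw [Complex.norm_intCast] at this
    linarith
  rw [norm_mul, norm_div, Complex.norm_I, Complex.norm_of_nonneg (ha n)]
  have : 1 / ‖z - n‖ ≤ 1 / (R / 2) := by gcongr
  calc a n * (1 / ‖z - n‖) ≤ a n * (1 / (R / 2)) := by gcongr; exact ha n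
    _ = _ := by field_simp

lemma contour {p : ℝ} (hp : 1 < p) {F : Finset ℤ} {a : ℤ → ℝ} (ha : ∀ n, 0 ≤ a n)
    (hex : ∃ n ∈ F, 0 < a n) {R : ℝ} (hR : 2 * ∑ n ∈ F, |(n : ℝ)| + 1 ≤ R) :
    ‖∫ x in (-R)..R, Fz F a (x + I) ^ (p : ℂ)‖ ≤ 4 * (2 * (∑ n ∈ F, a n)) ^ p * R ^ (1 - p) := by
  have hp0 : 0 < p := by linarith
  have hs : 0 ≤ ∑ n ∈ F, |(n : ℝ)| := Finset.sum_nonneg fun n _ => abs_nonneg _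
  have hsa : 0 ≤ ∑ n ∈ F, a n := Finset.sum_nonneg fun n _ => ha _
  have hR1 : 1 ≤ R := by linarith
  have hR0 : 0 < R := by linarith
  set B := (2 * (∑ n ∈ F, a n) / R) ^ p with hB
  have hb : ∀ z : ℂ, R ≤ ‖z‖ → ‖Fz F a z ^ (p : ℂ)‖ ≤ B := by
    intro z hz
    rw [Complex.norm_cpow_real]
    exact Real.rpow_le_rpow (norm_nonneg _) (Fz_bound F ha hR hz) hp0.le
  have h := integral_boundary_rect_eq_zero_of_differentiableOn (fun z => Fz F a z ^ (p : ℂ))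
    (-R + I) (R + R * I) (by
      intro z hz
      refine (Fz_cpow_diff ha hex p ?_).differentiableWithinAt
      have := hz.2
      simp only [Set.mem_preimage] at this
      have h2 : z.im ∈ Set.uIcc (1 : ℝ) R := by simpa using this
      rw [Set.uIcc_of_le hR1] at h2
      linarith [h2.1])
  simp only [add_re, neg_re, ofReal_re, I_re, add_zero, mul_re, ofReal_im, I_im, mul_one, mul_zero,
    sub_zero, neg_im, neg_zero, zero_add, add_im, mul_im, ofReal_one, one_mul,
    ofReal_neg] at h
  set i1 := ∫ x in (-R)..R, Fz F a (x + I) ^ (p : ℂ)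
  set i2 := ∫ x in (-R)..R, Fz F a (x + R * I) ^ (p : ℂ) with hi2
  set i3 := ∫ x in (1)..R, Fz F a (R + x * I) ^ (p : ℂ) with hi3
  set i4 := ∫ x in (1)..R, Fz F a (-R + x * I) ^ (p : ℂ) with hi4
  have e2 : ‖i2‖ ≤ B * |R - (-R)| := by
    refine intervalIntegral.norm_integral_le_of_norm_le_const fun x _ => hb _ ?_
    have := Complex.abs_im_le_norm (x + R * I)
    simpa [abs_of_pos hR0] using this
  have e3 : ‖i3‖ ≤ B * |R - 1| := by
    refine intervalIntegral.norm_integral_le_of_norm_le_const fun x _ => hb _ ?_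
    have := Complex.abs_re_le_norm (R + x * I)
    simpa [abs_of_pos hR0] using this
  have e4 : ‖i4‖ ≤ B * |R - 1| := by
    refine intervalIntegral.norm_integral_le_of_norm_le_const fun x _ => hb _ ?_
    have := Complex.abs_re_le_norm (-R + x * I)
    simpa [abs_of_pos hR0] using this
  rw [abs_of_nonneg (by linarith)] at e2 e3 e4
  have hB0 : 0 ≤ B := by positivity
  have : i1 = i2 - I • i3 + I • i4 := by linear_combination h
  have e5 : ‖i1‖ ≤ ‖i2‖ + ‖i3‖ + ‖i4‖ := by
    rw [this]
    refine (norm_add_le _ _).trans ?_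
    gcongr
    · refine (norm_sub_le _ _).trans ?_
      rw [norm_smul]; simp
    · rw [norm_smul]; simp
  have e6 : ‖i1‖ ≤ 4 * (B * R) := by nlinarith
  refine e6.trans (le_of_eq ?_)
  rw [hB, Real.div_rpow (by positivity) hR0.le, Real.rpow_sub hR0, Real.rpow_one]
  field_simp

lemma cell_w (j : ℤ) {t : ℝ} (ht : |t| ≤ 1) : 1 / (1 + ((j : ℝ) + t) ^ 2) ≤ 3 * w j := by
  unfold w
  rw [mul_one_div, div_le_div_iff₀ (by positivity) (by positivity)]
  have := abs_le.1 ht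
  nlinarith [sq_nonneg ((j : ℝ) + 2 * t)]

lemma norm_real_add_I (s : ℝ) : ‖(s : ℂ) + I‖ = Real.sqrt (1 + s ^ 2) := by
  rw [Complex.norm_eq_sqrt_sq_add_sq]; simp [add_comm]

lemma inv_sqrt_bound (j : ℤ) {t : ℝ} (ht : |t| ≤ 1) :
    1 / Real.sqrt (1 + ((j : ℝ) + t) ^ 2) * (1 / Real.sqrt (1 + (j : ℝ) ^ 2)) ≤ 3 * w j := by
  have h1 := cell_w j ht
  have hw := w_pos j
  have e1 : (1 / Real.sqrt (1 + ((j : ℝ) + t) ^ 2)) ^ 2 = 1 / (1 + ((j : ℝ) + t) ^ 2) := by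
    rw [div_pow, Real.sq_sqrt (by positivity)]; simp
  have e2 : (1 / Real.sqrt (1 + (j : ℝ) ^ 2)) ^ 2 = w j := by
    rw [div_pow, Real.sq_sqrt (by positivity)]; simp [w]
  nlinarith [sq_nonneg (1 / Real.sqrt (1 + ((j : ℝ) + t) ^ 2) - 1 / Real.sqrt (1 + (j : ℝ) ^ 2))]

lemma ker_diff (j : ℤ) {t : ℝ} (ht : |t| ≤ 1) :
    ‖ker j - 1 / (((j + t : ℝ) : ℂ) + I)‖ ≤ 3 * w j := by
  have n1 : ‖(j : ℂ) + I‖ = Real.sqrt (1 + (j : ℝ) ^ 2) := by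
    have := norm_real_add_I j; simpa using this
  have n2 := norm_real_add_I (j + t)
  have z1 : (j : ℂ) + I ≠ 0 := by rw [← norm_pos_iff, n1]; positivity
  have z2 : ((j + t : ℝ) : ℂ) + I ≠ 0 := by rw [← norm_pos_iff, n2]; positivity
  have : ker j - 1 / (((j + t : ℝ) : ℂ) + I) =
      t * (1 / (((j + t : ℝ) : ℂ) + I) * (1 / ((j : ℂ) + I))) := by
    unfold ker
    field_simp
    push_cast; ring
  rw [this, norm_mul, norm_mul, norm_div, norm_div, n1, n2, norm_one, Complex.norm_real]
  exact (mul_le_of_le_one_left (by positivity) ht).trans (inv_sqrt_bound j ht)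

lemma cell_pos {F : Finset ℤ} {a : ℤ → ℝ} (ha : ∀ n, 0 ≤ a n) (m : ℤ) {x : ℝ}
    (hx : |x - m| ≤ 1) :
    ‖∑ n ∈ F, (a n : ℂ) * ker (m - n)‖ ≤ ‖Fz F a (x + I)‖ + 3 * ∑ n ∈ F, w (m - n) * a n
    ∧ (Fz F a (x + I)).re ≤ 3 * ∑ n ∈ F, w (m - n) * a n := by
  constructor
  · have e : Fz F a (x + I) = I * ∑ n ∈ F, (a n : ℂ) * (1 / ((((m - n : ℤ) + (x - m) : ℝ) : ℂ) + I)) := by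
      unfold Fz
      rw [Finset.mul_sum]
      refine Finset.sum_congr rfl fun n _ => ?_
      have : (x : ℂ) + I - n = (((m - n : ℤ) + (x - m) : ℝ) : ℂ) + I := by push_cast; ring
      rw [this]; ring
    rw [e, norm_mul, Complex.norm_I, one_mul]
    refine (norm_le_norm_add_norm_sub' _
      (∑ n ∈ F, (a n : ℂ) * (1 / ((((m - n : ℤ) + (x - m) : ℝ) : ℂ) + I)))).trans ?_
    gcongr
    rw [← Finset.sum_sub_distrib, Finset.mul_sum]
    refine (norm_sum_le _ _).trans (Finset.sum_le_sum fun n _ => ?_)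
    rw [← mul_sub, norm_mul, Complex.norm_of_nonneg (ha n)]
    nlinarith [ker_diff (m - n) hx, ha n]
  · rw [Fz_re, Finset.mul_sum]
    refine Finset.sum_le_sum fun n _ => ?_
    have : ((x : ℂ) + I).im / normSq ((x : ℂ) + I - n) = 1 / (1 + (((m - n : ℤ) : ℝ) + (x - m)) ^ 2) := by
      rw [Complex.normSq_apply]; simp; ring
    rw [this]
    nlinarith [cell_w (m - n) hx, ha n]

lemma main_pos {p : ℝ} (hp : 1 < p) (hp2 : p ≤ 2) : ∃ C : ℝ, 0 ≤ C ∧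
    ∀ (S F : Finset ℤ) (a : ℤ → ℝ), (∀ n, 0 ≤ a n) →
      ∑ m ∈ S, ‖∑ n ∈ F, (a n : ℂ) * ker (m - n)‖ ^ p ≤ C * ∑ n ∈ F, a n ^ p := by
  have hp0 : 0 < p := by linarith
  obtain ⟨A, B, hA, hB, hpt⟩ := pointwise hp hp2
  refine ⟨2 ^ p * (A + 1) * 3 ^ p * W ^ p, by have := W_pos; positivity, fun S F a ha => ?_⟩
  by_cases hex : ∃ n ∈ F, 0 < a n
  swap
  · push Not at hex
    have h0 : ∀ n ∈ F, a n = 0 := fun n hn => le_antisymm (hex n hn) (ha n)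
    have e1 : ∀ m ∈ S, ‖∑ n ∈ F, (a n : ℂ) * ker (m - n)‖ ^ p = 0 := by
      intro m _
      rw [Finset.sum_eq_zero (fun n hn => by rw [h0 n hn]; simp)]
      simp [hp0.ne']
    rw [Finset.sum_eq_zero e1]
    have := W_pos
    have : 0 ≤ ∑ n ∈ F, a n ^ p := Finset.sum_nonneg fun n _ => Real.rpow_nonneg (ha n) _
    positivity
  set G : ℝ → ℂ := fun x => Fz F a (x + I) ^ (p : ℂ) with hG
  have hGc : Continuous G := by
    rw [continuous_iff_continuousAt]
    intro x
    have h1 : ContinuousAt (fun z => Fz F a z ^ (p : ℂ)) ((x : ℂ) + I) :=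
      (Fz_cpow_diff ha hex p (by simp)).continuousAt
    exact ContinuousAt.comp (f := fun x : ℝ => (x : ℂ) + I) h1 (by fun_prop)
  set Y : ℤ → ℝ := fun m => ∑ n ∈ F, w (m - n) * a n with hY
  have hY0 : ∀ m, 0 ≤ Y m := fun m => Finset.sum_nonneg fun n _ => mul_nonneg (w_pos _).le (ha n)
  -- cell estimate
  have cell : ∀ m : ℤ, ‖∑ n ∈ F, (a n : ℂ) * ker (m - n)‖ ^ p ≤
      2 ^ p * ((A + 1) * (3 * Y m) ^ p) - 2 ^ p * B * (∫ x in (m : ℝ)..(m + 1 : ℝ), G x).re := by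
    intro m
    have hpw : ∀ x ∈ Set.Icc (m : ℝ) (m + 1), ‖∑ n ∈ F, (a n : ℂ) * ker (m - n)‖ ^ p ≤
        2 ^ p * ((A + 1) * (3 * Y m) ^ p) - 2 ^ p * B * (G x).re := by
      intro x hx
      have hx' : |x - m| ≤ 1 := by rw [abs_le]; constructor <;> linarith [hx.1, hx.2]
      obtain ⟨c1, c2⟩ := cell_pos (F := F) ha m hx'
      have hre := Fz_re_pos (z := (x : ℂ) + I) ha hex (by simp)
      have h1 := hpt _ hre
      have h2 : (Fz F a (x + I)).re ^ p ≤ (3 * Y m) ^ p := Real.rpow_le_rpow hre.le c2 hp0.le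
      calc _ ≤ (‖Fz F a (x + I)‖ + 3 * Y m) ^ p := Real.rpow_le_rpow (norm_nonneg _) c1 hp0.le
        _ ≤ 2 ^ p * (‖Fz F a (x + I)‖ ^ p + (3 * Y m) ^ p) :=
            add_rpow_le hp0 (norm_nonneg _) (by have := hY0 m; positivity)
        _ ≤ 2 ^ p * ((A * (3 * Y m) ^ p - B * (G x).re) + (3 * Y m) ^ p) := by
            gcongr
            refine h1.trans ?_
            gcongr
        _ = _ := by ring
    have hmono := intervalIntegral.integral_mono_on (a := (m : ℝ)) (b := m + 1) (μ := volume)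
      (f := fun _ => ‖∑ n ∈ F, (a n : ℂ) * ker (m - n)‖ ^ p)
      (g := fun x => 2 ^ p * ((A + 1) * (3 * Y m) ^ p) - 2 ^ p * B * (G x).re)
      (by linarith) (by simp) (Continuous.intervalIntegrable (by fun_prop) _ _) hpw
    rw [intervalIntegral.integral_sub (by simp)
      (Continuous.intervalIntegrable (by fun_prop) _ _),
      intervalIntegral.integral_const_mul (2 ^ p * B)] at hmono
    have hre : ∫ x in (m : ℝ)..(m + 1 : ℝ), (G x).re = (∫ x in (m : ℝ)..(m + 1 : ℝ), G x).re := by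
      have := Complex.reCLM.intervalIntegral_comp_comm (hGc.intervalIntegrable (μ := volume) (m : ℝ) (m + 1))
      simpa using this
    rw [hre] at hmono
    simpa using hmono
  -- summation over cells
  have total : ∀ R : ℕ, (∀ m ∈ S, |m| < R) → 2 * ∑ n ∈ F, |(n : ℝ)| + 1 ≤ R →
      ∑ m ∈ S, ‖∑ n ∈ F, (a n : ℂ) * ker (m - n)‖ ^ p ≤
        2 ^ p * (A + 1) * 3 ^ p * W ^ p * ∑ n ∈ F, a n ^ p +
        2 ^ p * B * (4 * (2 * (∑ n ∈ F, a n)) ^ p * (R : ℝ) ^ (1 - p)) := by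
    intro R hS hR
    set e : ℕ ↪ ℤ := ⟨fun j => (j : ℤ) - R, fun x y h => by simpa using h⟩
    have he : ∀ j, e j = (j : ℤ) - R := fun _ => rfl
    set T := (Finset.range (2 * R)).map e with hT
    have hST : S ⊆ T := by
      intro m hm
      have := abs_lt.1 (hS m hm)
      rw [hT, Finset.mem_map]
      refine ⟨(m + R).toNat, ?_, ?_⟩
      · rw [Finset.mem_range]; omega
      · rw [he]; omega
    have hint : ∑ m ∈ T, ∫ x in (m : ℝ)..(m + 1 : ℝ), G x = ∫ x in (-R : ℝ)..R, G x := by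
      rw [hT, Finset.sum_map]
      have := intervalIntegral.sum_integral_adjacent_intervals (f := G) (μ := volume)
        (a := fun j : ℕ => (j : ℝ) - R) (n := 2 * R) (fun k _ => hGc.intervalIntegrable _ _)
      convert this using 2
      · rename_i j hj
        rw [he]
        push_cast
        congr 1; ring
      · simp
      · push_cast; ring
    calc _ ≤ ∑ m ∈ T, ‖∑ n ∈ F, (a n : ℂ) * ker (m - n)‖ ^ p :=
          Finset.sum_le_sum_of_subset_of_nonneg hST fun m _ _ => Real.rpow_nonneg (norm_nonneg _) _
      _ ≤ ∑ m ∈ T, (2 ^ p * ((A + 1) * (3 * Y m) ^ p)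
            - 2 ^ p * B * (∫ x in (m : ℝ)..(m + 1 : ℝ), G x).re) :=
          Finset.sum_le_sum fun m _ => cell m
      _ = 2 ^ p * (A + 1) * 3 ^ p * (∑ m ∈ T, Y m ^ p) + 2 ^ p * B * (-(∫ x in (-R : ℝ)..R, G x).re) := by
          rw [Finset.sum_sub_distrib, ← Finset.mul_sum, ← Finset.mul_sum, ← Finset.mul_sum,
            ← Complex.re_sum, hint]
          have : ∑ m ∈ T, (3 * Y m) ^ p = 3 ^ p * ∑ m ∈ T, Y m ^ p := by
            rw [Finset.mul_sum]
            exact Finset.sum_congr rfl fun m _ => Real.mul_rpow (by norm_num) (hY0 m)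
          rw [this]; ring
      _ ≤ _ := by
          rw [mul_assoc (2 ^ p * (A + 1) * 3 ^ p)]
          gcongr
          · exact young hp T F a ha
          · exact (neg_le_abs _).trans ((Complex.abs_re_le_norm _).trans (contour hp ha hex hR))
  have hlim : Filter.Tendsto (fun R : ℕ => 2 ^ p * (A + 1) * 3 ^ p * W ^ p * ∑ n ∈ F, a n ^ p +
        2 ^ p * B * (4 * (2 * (∑ n ∈ F, a n)) ^ p * (R : ℝ) ^ (1 - p))) Filter.atTop
        (nhds (2 ^ p * (A + 1) * 3 ^ p * W ^ p * ∑ n ∈ F, a n ^ p +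
        2 ^ p * B * (4 * (2 * (∑ n ∈ F, a n)) ^ p * 0))) := by
    have h0 : Filter.Tendsto (fun R : ℕ => (R : ℝ) ^ (1 - p)) Filter.atTop (nhds 0) := by
      have := (tendsto_rpow_neg_atTop (y := p - 1) (by linarith)).comp (tendsto_natCast_atTop_atTop (R := ℝ))
      simpa [Function.comp_def] using this
    exact ((h0.const_mul _).const_mul _).const_add _
  simp only [mul_zero, add_zero] at hlim
  refine ge_of_tendsto hlim ?_
  have ev1 : ∀ᶠ R : ℕ in Filter.atTop, 2 * ∑ n ∈ F, |(n : ℝ)| + 1 ≤ R :=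
    tendsto_natCast_atTop_atTop.eventually_ge_atTop _
  have ev2 : ∀ᶠ R : ℕ in Filter.atTop, ∀ m ∈ S, |m| < (R : ℤ) := by
    rw [Filter.eventually_all_finset]
    intro m _
    filter_upwards [Filter.eventually_gt_atTop m.natAbs] with R hR
    rw [Int.abs_eq_natAbs]
    omega
  filter_upwards [ev1, ev2] with R h1 h2 using total R h2 h1

lemma KB_ker_le2 {p : ℝ} (hp : 1 < p) (hp2 : p ≤ 2) : ∃ C : ℝ, 0 ≤ C ∧ KB p ker C := by
  have hp0 : 0 < p := by linarith
  obtain ⟨C, hC, hmain⟩ := main_pos hp hp2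
  refine ⟨2 ^ p * (2 ^ p * (4 * C)), by positivity, fun S F a => ?_⟩
  set N := ∑ n ∈ F, ‖a n‖ ^ p with hN
  set L : (ℤ → ℝ) → ℤ → ℂ := fun b m => ∑ n ∈ F, (b n : ℂ) * ker (m - n) with hL
  have hb : ∀ b : ℤ → ℝ, (∀ n, 0 ≤ b n) → (∀ n, b n ≤ ‖a n‖) → ∑ m ∈ S, ‖L b m‖ ^ p ≤ C * N := by
    intro b h0 h1
    refine (hmain S F b h0).trans ?_
    refine mul_le_mul_of_nonneg_left (Finset.sum_le_sum fun n _ => ?_) hC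
    exact Real.rpow_le_rpow (h0 n) (h1 n) hp0.le
  set b1 : ℤ → ℝ := fun n => max (a n).re 0 with h1
  set b2 : ℤ → ℝ := fun n => max (-(a n).re) 0 with h2
  set b3 : ℤ → ℝ := fun n => max (a n).im 0 with h3
  set b4 : ℤ → ℝ := fun n => max (-(a n).im) 0 with h4
  have c1 := hb b1 (fun n => le_max_right _ _) (fun n => max_le ((le_abs_self _).trans (Complex.abs_re_le_norm _)) (norm_nonneg _))
  have c2 := hb b2 (fun n => le_max_right _ _) (fun n => max_le ((neg_le_abs _).trans (Complex.abs_re_le_norm _)) (norm_nonneg _))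
  have c3 := hb b3 (fun n => le_max_right _ _) (fun n => max_le ((le_abs_self _).trans (Complex.abs_im_le_norm _)) (norm_nonneg _))
  have c4 := hb b4 (fun n => le_max_right _ _) (fun n => max_le ((neg_le_abs _).trans (Complex.abs_im_le_norm _)) (norm_nonneg _))
  have hmx : ∀ x : ℝ, max x 0 - max (-x) 0 = x := by
    intro x
    rcases le_total x 0 with h | h
    · rw [max_eq_right h, max_eq_left (by linarith)]; ring
    · rw [max_eq_left h, max_eq_right (by linarith)]; ring
  have hdec : ∀ m, ∑ n ∈ F, a n * ker (m - n) = (L b1 m - L b2 m) + I * (L b3 m - L b4 m) := by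
    intro m
    simp only [hL]
    rw [← Finset.sum_sub_distrib, ← Finset.sum_sub_distrib, Finset.mul_sum,
      ← Finset.sum_add_distrib]
    refine Finset.sum_congr rfl fun n _ => ?_
    have e : a n = ((b1 n - b2 n : ℝ) : ℂ) + ((b3 n - b4 n : ℝ) : ℂ) * I := by
      simp only [h1, h2, h3, h4, hmx]
      exact (Complex.re_add_im _).symm
    conv_lhs => rw [e]
    push_cast; ring
  have hpt : ∀ m, ‖∑ n ∈ F, a n * ker (m - n)‖ ^ p ≤ 2 ^ p * (2 ^ p * (‖L b1 m‖ ^ p + ‖L b2 m‖ ^ p)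
      + 2 ^ p * (‖L b3 m‖ ^ p + ‖L b4 m‖ ^ p)) := by
    intro m
    calc _ ≤ ((‖L b1 m‖ + ‖L b2 m‖) + (‖L b3 m‖ + ‖L b4 m‖)) ^ p := by
          refine Real.rpow_le_rpow (norm_nonneg _) ?_ hp0.le
          rw [hdec]
          refine (norm_add_le _ _).trans ?_
          rw [norm_mul, Complex.norm_I, one_mul]
          gcongr <;> exact norm_sub_le _ _
      _ ≤ 2 ^ p * ((‖L b1 m‖ + ‖L b2 m‖) ^ p + (‖L b3 m‖ + ‖L b4 m‖) ^ p) :=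
          add_rpow_le hp0 (by positivity) (by positivity)
      _ ≤ _ := by
          gcongr <;> exact add_rpow_le hp0 (by positivity) (by positivity)
  calc _ ≤ _ := Finset.sum_le_sum fun m _ => hpt m
    _ = 2 ^ p * (2 ^ p * ((∑ m ∈ S, ‖L b1 m‖ ^ p + ∑ m ∈ S, ‖L b2 m‖ ^ p) +
          (∑ m ∈ S, ‖L b3 m‖ ^ p + ∑ m ∈ S, ‖L b4 m‖ ^ p))) := by
        rw [← Finset.mul_sum, Finset.sum_add_distrib, ← Finset.mul_sum, ← Finset.mul_sum,
          Finset.sum_add_distrib, Finset.sum_add_distrib]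
        ring
    _ ≤ 2 ^ p * (2 ^ p * (4 * (C * N))) := by gcongr; linarith
    _ = _ := by ring

lemma ker_neg (j : ℤ) : ker (-j) = -(starRingEnd ℂ) (ker j) := by
  unfold ker
  rw [map_div₀, map_add, map_one, Complex.conj_I, map_intCast, ← div_neg]
  push_cast
  congr 1; ring

lemma KB_dual {p q C : ℝ} (hpq : p.HolderConjugate q) (hC : 0 ≤ C) (h : KB q ker C) :
    KB p ker (C ^ (p - 1)) := by
  intro S F a
  have hp1 : 1 < p := hpq.lt
  have hp0 : 0 < p := by linarith
  set B : ℤ → ℂ := fun m => ∑ n ∈ F, a n * ker (m - n) with hB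
  set X := ∑ m ∈ S, ‖B m‖ ^ p with hX
  set N := ∑ n ∈ F, ‖a n‖ ^ p with hN
  have hX0 : 0 ≤ X := Finset.sum_nonneg fun m _ => Real.rpow_nonneg (norm_nonneg _) _
  have hN0 : 0 ≤ N := Finset.sum_nonneg fun m _ => Real.rpow_nonneg (norm_nonneg _) _
  set b : ℤ → ℂ := fun m => (starRingEnd ℂ) (B m) * ((‖B m‖ ^ (p - 2) : ℝ) : ℂ) with hb
  have hbn : ∀ m, ‖b m‖ = ‖B m‖ ^ (p - 1) := by
    intro m
    simp only [hb]
    rw [norm_mul, RCLike.norm_conj, Complex.norm_of_nonneg (Real.rpow_nonneg (norm_nonneg _) _)]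
    rcases eq_or_lt_of_le (norm_nonneg (B m)) with h0 | h0
    · rw [← h0, zero_mul, Real.zero_rpow (by linarith)]
    · nth_rewrite 1 [← Real.rpow_one ‖B m‖]
      rw [← Real.rpow_add h0]; congr 1; ring
  have hbq : ∀ m, ‖b m‖ ^ q = ‖B m‖ ^ p := by
    intro m
    rw [hbn, ← Real.rpow_mul (norm_nonneg _), hpq.sub_one_mul_conj]
  have hbB : ∀ m, b m * B m = ((‖B m‖ ^ p : ℝ) : ℂ) := by
    intro m
    simp only [hb]
    rw [mul_right_comm, mul_comm _ (B m), Complex.mul_conj, Complex.normSq_eq_norm_sq,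
      ← Complex.ofReal_mul]
    congr 1
    rcases eq_or_lt_of_le (norm_nonneg (B m)) with h0 | h0
    · rw [← h0, Real.zero_rpow hp0.ne']; simp
    · rw [← Real.rpow_natCast, ← Real.rpow_add h0]; congr 1; push_cast; ring
  set E : ℤ → ℂ := fun n => ∑ m ∈ S, b m * ker (m - n) with hE
  have hEs : ∑ n ∈ F, ‖E n‖ ^ q ≤ C * X := by
    have h1 := h F S (fun m => (starRingEnd ℂ) (b m))
    simp only [RCLike.norm_conj, hbq] at h1
    refine le_trans (le_of_eq ?_) h1
    refine Finset.sum_congr rfl fun n _ => ?_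
    congr 1
    rw [← RCLike.norm_conj, ← norm_neg]
    congr 1
    simp only [hE]
    rw [map_sum, ← Finset.sum_neg_distrib]
    refine Finset.sum_congr rfl fun m _ => ?_
    have : m - n = -(n - m) := by ring
    rw [this, ker_neg]
    simp
  have hXE : X ≤ N ^ (1 / p) * (C * X) ^ (1 / q) := by
    have e1 : (X : ℂ) = ∑ n ∈ F, a n * E n := by
      rw [hX, Complex.ofReal_sum]
      simp_rw [← hbB, hB, hE, Finset.mul_sum]
      rw [Finset.sum_comm]
      refine Finset.sum_congr rfl fun n _ => Finset.sum_congr rfl fun m _ => ?_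
      ring
    have e2 : X = ‖(X : ℂ)‖ := by rw [Complex.norm_of_nonneg hX0]
    rw [e2, e1]
    calc _ ≤ ∑ n ∈ F, ‖a n‖ * ‖E n‖ := (norm_sum_le _ _).trans (by simp)
      _ ≤ _ := Real.inner_le_Lp_mul_Lq_of_nonneg F hpq (fun _ _ => norm_nonneg _) (fun _ _ => norm_nonneg _)
      _ ≤ _ := by
        have := hpq.symm.pos
        rw [← e1, ← e2]
        gcongr
  rcases eq_or_lt_of_le hX0 with h0 | h0
  · rw [← h0]; positivity
  have h3 : X ^ p ≤ N * (C * X) ^ (p - 1) := by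
    calc X ^ p ≤ (N ^ (1 / p) * (C * X) ^ (1 / q)) ^ p := Real.rpow_le_rpow hX0 hXE hp0.le
      _ = _ := by
        rw [Real.mul_rpow (by positivity) (by positivity), ← Real.rpow_mul hN0,
          ← Real.rpow_mul (by positivity), one_div_mul_cancel hp0.ne', Real.rpow_one]
        congr 2
        have hq := hpq.symm.pos
        have := hpq.sub_one_mul_conj
        field_simp
        linarith
  rw [Real.mul_rpow hC hX0, Real.rpow_sub h0, Real.rpow_one] at h3
  have hXp : 0 < X ^ p := by positivity
  have h4 : X ^ p * X ≤ X ^ p * (C ^ (p - 1) * N) := by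
    calc X ^ p * X ≤ (N * (C ^ (p - 1) * (X ^ p / X))) * X := by gcongr
      _ = _ := by field_simp
  exact le_of_mul_le_mul_left h4 hXp

lemma KB_ker {p : ℝ} (hp : 1 < p) : ∃ C : ℝ, 0 ≤ C ∧ KB p ker C := by
  rcases le_total p 2 with h | h
  · exact KB_ker_le2 hp h
  · have hpq := Real.HolderConjugate.conjExponent hp
    obtain ⟨C, hC, hk⟩ := KB_ker_le2 (p := p.conjExponent) hpq.symm.lt (by
      unfold Real.conjExponent
      rw [div_le_iff₀ (by linarith)]; linarith)
    exact ⟨_, by positivity, KB_dual hpq hC hk⟩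

noncomputable def sk (t : ℝ) (j : ℤ) : ℂ := (Real.sinc (Real.pi * (j + t)) : ℝ)

lemma sinc_mul (x : ℝ) : Real.sinc x * x = Real.sin x := by
  by_cases h : x = 0
  · simp [h]
  · rw [Real.sinc_of_ne_zero h]; field_simp

lemma sinc_bound (s : ℝ) : |Real.sinc (Real.pi * s)| ≤ 2 * (1 / Real.sqrt (1 + s ^ 2)) := by
  rw [mul_one_div, le_div_iff₀ (by positivity)]
  apply abs_le_of_sq_le_sq' _ (by norm_num) |>.2
  rw [mul_pow, sq_abs, Real.sq_sqrt (by positivity)]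
  have h1 := Real.abs_sinc_le_one (Real.pi * s)
  have h2 := sinc_mul (Real.pi * s)
  have h3 := Real.sin_sq_le_one (Real.pi * s)
  rw [← h2] at h3
  have h4 : Real.sinc (Real.pi * s) ^ 2 ≤ 1 := by rw [sq_le_one_iff_abs_le_one]; exact h1
  have h5 : (1 : ℝ) ≤ Real.pi ^ 2 := by nlinarith [Real.pi_gt_three]
  nlinarith [mul_le_mul_of_nonneg_right h5 (sq_nonneg (Real.sinc (Real.pi * s) * s))]

lemma KB_sk {p : ℝ} (hp : 1 < p) : ∃ C : ℝ, 0 ≤ C ∧ ∀ t : ℝ, |t| ≤ 1 → KB p (sk t) C := by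
  obtain ⟨C, hC, hk⟩ := KB_ker hp
  have hW := W_pos
  refine ⟨2 ^ p * (C + 12 ^ p * W ^ p), by positivity, fun t ht => ?_⟩
  set c : ℂ := ((Real.sin (Real.pi * t) / Real.pi : ℝ) : ℂ) with hc
  have hc1 : ‖c‖ ≤ 1 := by
    rw [hc, Complex.norm_real, Real.norm_eq_abs, abs_div, abs_of_pos Real.pi_pos,
      div_le_one Real.pi_pos]
    exact (Real.abs_sin_le_one _).trans (by linarith [Real.pi_gt_three])
  have h1 := hk.twist hp hC c hc1
  set d : ℤ → ℂ := fun j => sk t j - (-1) ^ j * c * ker j with hd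
  have hdb : ∀ j, ‖d j‖ ≤ 12 * w j := by
    intro j
    have n1 : ‖(j : ℂ) + I‖ = Real.sqrt (1 + (j : ℝ) ^ 2) := by
      have := norm_real_add_I j; simpa using this
    have z1 : (j : ℂ) + I ≠ 0 := by rw [← norm_pos_iff, n1]; positivity
    have hs : ((-1 : ℂ)) ^ j * c = sk t j * ((j + t : ℝ) : ℂ) := by
      have e := Real.sin_add_int_mul_pi (Real.pi * t) j
      have e2 := sinc_mul (Real.pi * (j + t))
      have e3 : Real.pi * t + j * Real.pi = Real.pi * (j + t) := by ring
      rw [e3, ← e2] at e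
      have e4 : (-1 : ℝ) ^ j * (Real.sin (Real.pi * t) / Real.pi) =
          Real.sinc (Real.pi * (j + t)) * (j + t) := by
        rw [mul_div_assoc', ← e]
        have := Real.pi_pos
        field_simp
      unfold sk
      rw [hc, ← Complex.ofReal_mul, ← e4]
      push_cast; rfl
    have e : d j = sk t j * (I - t) * (1 / ((j : ℂ) + I)) := by
      simp only [hd]
      rw [hs]; unfold ker
      field_simp
      push_cast; ring
    have hI : ‖I - (t : ℂ)‖ ≤ 2 := by
      refine (norm_sub_le _ _).trans ?_
      rw [Complex.norm_I, Complex.norm_real, Real.norm_eq_abs]; linarith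
    rw [e, norm_mul, norm_mul, norm_div, n1, norm_one]
    have hsk : ‖sk t j‖ ≤ 2 * (1 / Real.sqrt (1 + ((j : ℝ) + t) ^ 2)) := by
      unfold sk; rw [Complex.norm_real]; exact sinc_bound _
    calc _ ≤ 2 * (1 / Real.sqrt (1 + ((j : ℝ) + t) ^ 2)) * 2 * (1 / Real.sqrt (1 + (j : ℝ) ^ 2)) := by
          gcongr
      _ ≤ _ := by linarith [inv_sqrt_bound j ht]
  have h2 := h1.add hp (KB_young hp (by norm_num) hdb)
  have e : (fun j => (-1) ^ j * c * ker j + d j) = sk t := by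
    ext j; simp only [hd]; ring
  rwa [e] at h2

lemma norm_sk_le (t : ℝ) (j : ℤ) : ‖sk t j‖ ≤ 1 := by
  unfold sk; rw [Complex.norm_real]; exact Real.abs_sinc_le_one _

lemma core {p : ℝ} (hp : 1 < p) : ∃ C : ℝ, 0 < C ∧ ∀ t : ℝ, |t| ≤ 1 → ∀ a : ℤ → ℂ,
    Summable (fun n => ‖a n‖) → Summable (fun n => ‖a n‖ ^ p) → ∀ S : Finset ℤ,
    ∑ m ∈ S, ‖∑' n, a n * sk t (m - n)‖ ^ p ≤ C * ∑' n, ‖a n‖ ^ p := by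
  have hp0 : 0 < p := by linarith
  obtain ⟨C, hC, h⟩ := KB_sk hp
  refine ⟨C + 1, by linarith, fun t ht a ha hap S => ?_⟩
  have hs : ∀ m, HasSum (fun n => a n * sk t (m - n)) (∑' n, a n * sk t (m - n)) := by
    intro m
    refine Summable.hasSum (Summable.of_norm_bounded ha fun n => ?_)
    rw [norm_mul]
    exact mul_le_of_le_one_right (norm_nonneg _) (norm_sk_le _ _)
  have hl : Filter.Tendsto (fun F : Finset ℤ => ∑ m ∈ S, ‖∑ n ∈ F, a n * sk t (m - n)‖ ^ p)
      Filter.atTop (nhds (∑ m ∈ S, ‖∑' n, a n * sk t (m - n)‖ ^ p)) := by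
    refine tendsto_finsetSum _ fun m _ => ?_
    exact ((hs m).norm).rpow_const (Or.inr hp0.le)
  refine le_of_tendsto hl (Filter.Eventually.of_forall fun F => ?_)
  refine (h t ht S F a).trans ?_
  have h0 : ∑ n ∈ F, ‖a n‖ ^ p ≤ ∑' n, ‖a n‖ ^ p :=
    hap.sum_le_tsum F fun n _ => Real.rpow_nonneg (norm_nonneg _) _
  have h1 : 0 ≤ ∑ n ∈ F, ‖a n‖ ^ p := Finset.sum_nonneg fun n _ => Real.rpow_nonneg (norm_nonneg _) _
  nlinarith

open scoped FourierTransform SchwartzMap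

lemma schwartz_bound (g : 𝓢(ℝ, ℂ)) : ∃ M : ℝ, 0 ≤ M ∧ ∀ y : ℝ, ‖g y‖ ≤ M * (1 / (1 + y ^ 2)) := by
  obtain ⟨C0, h0, hC0⟩ := g.decay 0 0
  obtain ⟨C2, h2, hC2⟩ := g.decay 2 0
  refine ⟨C0 + C2, by positivity, fun y => ?_⟩
  have e0 := hC0 y
  have e2 := hC2 y
  simp only [norm_iteratedFDeriv_zero, pow_zero, one_mul, Real.norm_eq_abs, sq_abs] at e0 e2
  rw [mul_one_div, le_div_iff₀ (by positivity)]
  linarith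

lemma summable_samples (g : 𝓢(ℝ, ℂ)) : Summable (fun n : ℤ => ‖g n‖) := by
  obtain ⟨M, hM, h⟩ := schwartz_bound g
  exact Summable.of_nonneg_of_le (fun n => norm_nonneg _) (fun n => h n) (w_summable.mul_left M)

lemma integral_exp_sinc (s : ℝ) :
    ∫ ξ in (-(1 / 2) : ℝ)..(1 / 2), Complex.exp (2 * Real.pi * s * I * ξ) = (Real.sinc (Real.pi * s) : ℝ) := by
  by_cases hs : s = 0
  · simp [hs]; norm_num
  have hpi := Real.pi_pos.ne'
  have hpc : (Real.pi : ℂ) ≠ 0 := by exact_mod_cast hpi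
  have hsc : (s : ℂ) ≠ 0 := by exact_mod_cast hs
  rw [integral_exp_mul_complex (by simp [hs, hpi, I_ne_zero])]
  rw [Real.sinc_of_ne_zero (by positivity)]
  push_cast
  rw [Complex.sin]
  have e1 : 2 * (Real.pi : ℂ) * s * I * (1 / 2) = Real.pi * s * I := by ring
  have e2 : 2 * (Real.pi : ℂ) * s * I * (-(1 / 2)) = -(Real.pi * s) * I := by ring
  rw [e1, e2]
  have hI := I_ne_zero
  field_simp
  rw [I_sq]; ring

lemma sampling (g : 𝓢(ℝ, ℂ)) (hg : ∀ ξ : ℝ, 1 / 2 < |ξ| → 𝓕 g ξ = 0) (x : ℝ) :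
    g x = ∑' n : ℤ, g n * ((Real.sinc (Real.pi * (x - n)) : ℝ) : ℂ) := by
  set G : 𝓢(ℝ, ℂ) := 𝓕 g with hG
  have hGG : ∀ y : ℝ, (𝓕 G) y = g (-y) := by
    intro y
    have h1 : (𝓕⁻ G) (-y) = g (-y) := by rw [hG, FourierTransform.fourierInv_fourier_eq]
    rw [← h1, SchwartzMap.fourierInv_coe, SchwartzMap.fourier_coe,
      Real.fourierInv_eq_fourier_neg, neg_neg]
  have h1 : g x = ∫ ξ in (-(1 / 2) : ℝ)..(1 / 2), Complex.exp (2 * Real.pi * x * I * ξ) * G ξ := by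
    have e : g x = (𝓕⁻ G) x := by rw [hG, FourierTransform.fourierInv_fourier_eq]
    rw [e, SchwartzMap.fourierInv_coe, Real.fourierInv_eq', intervalIntegral.integral_of_le (by norm_num),
      ← MeasureTheory.integral_indicator measurableSet_Ioc]
    apply MeasureTheory.integral_congr_ae
    have : ∀ᵐ ξ : ℝ, ξ ≠ -(1 / 2) := by simp [ae_iff]
    filter_upwards [this] with ξ hξ
    by_cases hm : ξ ∈ Set.Ioc (-(1 / 2) : ℝ) (1 / 2)
    · rw [Set.indicator_of_mem hm]
      simp only [smul_eq_mul]
      congr 2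
      simp
      ring
    · rw [Set.indicator_of_notMem hm]
      have : 1 / 2 < |ξ| := by
        by_contra hh
        push Not at hh
        have := abs_le.1 hh
        exact hm ⟨lt_of_le_of_ne this.1 (Ne.symm hξ), this.2⟩
      rw [hg ξ this]; simp
  have h2 : ∀ ξ : ℝ, |ξ| < 1 / 2 → G ξ = ∑' n : ℤ, g (-n) * Complex.exp (2 * Real.pi * n * I * ξ) := by
    intro ξ hξ
    have := SchwartzMap.tsum_eq_tsum_fourier G ξ
    rw [tsum_eq_single 0] at this
    · simp only [Int.cast_zero, add_zero] at this
      rw [this]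
      refine tsum_congr fun n => ?_
      rw [hGG, fourier_coe_apply]
      congr 2
      push_cast; ring
    · intro n hn
      apply hg
      have h1 : (1 : ℝ) ≤ |(n : ℝ)| := by exact_mod_cast Int.one_le_abs hn
      have h2 : |(n : ℝ)| ≤ |ξ + n| + |ξ| := by
        have := abs_sub (ξ + n) ξ
        simpa using this
      linarith
  have hsum : Summable (fun n : ℤ => ‖g (-n)‖) := by
    have := (Equiv.neg ℤ).summable_iff.2 (summable_samples g)
    simpa [Function.comp_def] using this
  have h3 : HasSum (fun n : ℤ => ∫ ξ in (-(1 / 2) : ℝ)..(1 / 2),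
      Complex.exp (2 * Real.pi * x * I * ξ) * (g (-n) * Complex.exp (2 * Real.pi * n * I * ξ))) (g x) := by
    rw [h1]
    refine intervalIntegral.hasSum_integral_of_dominated_convergence (fun n _ => ‖g (-n)‖) ?_ ?_ ?_ ?_ ?_
    · intro n
      exact Continuous.aestronglyMeasurable (by fun_prop)
    · intro n
      refine Filter.Eventually.of_forall fun ξ _ => ?_
      rw [norm_mul, norm_mul, Complex.norm_exp, Complex.norm_exp]
      simp
    · exact Filter.Eventually.of_forall fun ξ _ => hsum
    · simp
    · have : ∀ᵐ ξ : ℝ, ξ ≠ 1 / 2 := by simp [ae_iff]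
      filter_upwards [this] with ξ hξ hm
      rw [Set.uIoc_of_le (by norm_num)] at hm
      have hlt : |ξ| < 1 / 2 := abs_lt.2 ⟨hm.1, lt_of_le_of_ne hm.2 hξ⟩
      rw [h2 ξ hlt]
      refine (Summable.hasSum ?_).mul_left _
      refine Summable.of_norm_bounded hsum fun n => ?_
      rw [norm_mul, Complex.norm_exp]
      simp
  have h4 : ∀ n : ℤ, ∫ ξ in (-(1 / 2) : ℝ)..(1 / 2),
      Complex.exp (2 * Real.pi * x * I * ξ) * (g (-n) * Complex.exp (2 * Real.pi * n * I * ξ)) =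
      g (-n) * ((Real.sinc (Real.pi * (x + n)) : ℝ) : ℂ) := by
    intro n
    rw [← integral_exp_sinc, ← intervalIntegral.integral_const_mul]
    congr 1
    ext ξ
    rw [mul_left_comm, ← Complex.exp_add]
    congr 2
    push_cast; ring
  simp_rw [h4] at h3
  rw [← h3.tsum_eq, ← (Equiv.neg ℤ).tsum_eq]
  refine tsum_congr fun n => ?_
  simp [sub_eq_add_neg]

/-- translate comparison -/
lemma shift_bound {p : ℝ} (hp : 1 < p) : ∃ C : ℝ, 0 < C ∧ ∀ g : 𝓢(ℝ, ℂ),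
    (∀ ξ : ℝ, 1 / 2 < |ξ| → 𝓕 g ξ = 0) → ∀ t : ℝ, |t| ≤ 1 → ∀ S : Finset ℤ,
    ∑ m ∈ S, ‖g (m + t)‖ ^ p ≤ C * ∑' n : ℤ, ‖g n‖ ^ p := by
  obtain ⟨C, hC, h⟩ := core hp
  refine ⟨C, hC, fun g hg t ht S => ?_⟩
  have hs := summable_samples g
  have hsp : Summable (fun n : ℤ => ‖g n‖ ^ p) := by
    obtain ⟨M, hM, hb⟩ := schwartz_bound g
    refine Summable.of_nonneg_of_le (fun n => Real.rpow_nonneg (norm_nonneg _) _) (fun n => ?_)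
      (w_summable.mul_left (M ^ p))
    calc ‖g n‖ ^ p ≤ (M * w n) ^ p := Real.rpow_le_rpow (norm_nonneg _) (hb n) (by linarith)
      _ = M ^ p * w n ^ p := Real.mul_rpow hM (w_pos n).le
      _ ≤ M ^ p * w n := by
        gcongr
        refine Real.rpow_le_self_of_le_one (w_pos n).le ?_ hp.le
        unfold w
        rw [div_le_one (by positivity)]; nlinarith [sq_nonneg (n : ℝ)]
  refine le_trans (le_of_eq ?_) (h t ht (fun n => g n) hs hsp S)
  refine Finset.sum_congr rfl fun m _ => ?_
  rw [sampling g hg (m + t)]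
  congr 2
  refine tsum_congr fun n => ?_
  unfold sk
  push_cast
  congr 4; ring

lemma w_rpow_le {p : ℝ} (hp : 1 < p) (n : ℤ) : w n ^ p ≤ w n := by
  refine Real.rpow_le_self_of_le_one (w_pos n).le ?_ hp.le
  unfold w
  rw [div_le_one (by positivity)]; nlinarith [sq_nonneg (n : ℝ)]

lemma integrable_rpow {p : ℝ} (hp : 1 < p) (g : 𝓢(ℝ, ℂ)) : Integrable (fun x : ℝ => ‖g x‖ ^ p) := by
  obtain ⟨M, hM, hb⟩ := schwartz_bound g
  refine (integrable_inv_one_add_sq.const_mul (M ^ p)).mono' ?_ (Filter.Eventually.of_forall fun x => ?_)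
  · exact (Continuous.rpow_const (by fun_prop) (fun x => Or.inr (by linarith))).aestronglyMeasurable
  · rw [Real.norm_of_nonneg (Real.rpow_nonneg (norm_nonneg _) _)]
    calc ‖g x‖ ^ p ≤ (M * (1 / (1 + x ^ 2))) ^ p := Real.rpow_le_rpow (norm_nonneg _) (hb x) (by linarith)
      _ = M ^ p * (1 / (1 + x ^ 2)) ^ p := Real.mul_rpow hM (by positivity)
      _ ≤ M ^ p * (1 / (1 + x ^ 2)) := by
        gcongr
        refine Real.rpow_le_self_of_le_one (by positivity) ?_ hp.le
        rw [div_le_one (by positivity)]; nlinarith [sq_nonneg x]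
      _ = _ := by rw [one_div]

lemma unit_case {p : ℝ} (hp : 1 < p) : ∃ C : ℝ, 0 < C ∧ ∀ g : 𝓢(ℝ, ℂ),
    (∀ t : ℝ, ∀ ξ : ℝ, 1 / 2 < |ξ| → 𝓕 (g.compSubConstCLM ℂ t) ξ = 0) →
    ∑' n : ℤ, ‖g n‖ ^ p ≤ C * ∫ x : ℝ, ‖g x‖ ^ p
    ∧ ∫ x : ℝ, ‖g x‖ ^ p ≤ C * ∑' n : ℤ, ‖g n‖ ^ p := by
  obtain ⟨C, hC, h⟩ := shift_bound hp
  refine ⟨C, hC, fun g hg => ?_⟩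
  have hgi := integrable_rpow hp g
  have hgc : Continuous (fun x : ℝ => ‖g x‖ ^ p) :=
    Continuous.rpow_const (by fun_prop) (fun x => Or.inr (by linarith))
  have hS := hgi.hasSum_intervalIntegral_comp_add_int
  have hg0 : ∀ ξ : ℝ, 1 / 2 < |ξ| → 𝓕 g ξ = 0 := by
    intro ξ hξ
    have := hg 0 ξ hξ
    simpa using this
  constructor
  · set Φ : ℝ → ℝ := fun t => ∑' n : ℤ, ‖g (t + n)‖ ^ p with hΦ
    obtain ⟨M, hM, hb⟩ := schwartz_bound g
    have hbd : ∀ n : ℤ, ∀ t ∈ Set.Icc (0 : ℝ) 1, ‖‖g (t + n)‖ ^ p‖ ≤ (M * 3) ^ p * w n := by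
      intro n t ht
      rw [Real.norm_of_nonneg (Real.rpow_nonneg (norm_nonneg _) _)]
      have h1 := cell_w n (t := t) (abs_le.2 ⟨by linarith [ht.1], ht.2⟩)
      have hw := w_pos n
      calc ‖g (t + n)‖ ^ p ≤ (M * 3 * w n) ^ p := by
            refine Real.rpow_le_rpow (norm_nonneg _) ?_ (by linarith)
            refine (hb _).trans ?_
            rw [mul_assoc, add_comm t]
            gcongr
        _ = (M * 3) ^ p * w n ^ p := Real.mul_rpow (by positivity) hw.le
        _ ≤ _ := by gcongr; exact w_rpow_le hp n
    have hsum := w_summable.mul_left ((M * 3) ^ p)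
    have hΦc : ContinuousOn Φ (Set.Icc 0 1) := by
      refine continuousOn_tsum (fun n => ?_) hsum hbd
      exact (hgc.comp (by fun_prop : Continuous fun t : ℝ => t + n)).continuousOn
    have hΦS : HasSum (fun n : ℤ => ∫ t in (0 : ℝ)..1, ‖g (t + n)‖ ^ p) (∫ t in (0 : ℝ)..1, Φ t) := by
      refine intervalIntegral.hasSum_integral_of_dominated_convergence
        (fun n _ => (M * 3) ^ p * w n) ?_ ?_ ?_ ?_ ?_
      · intro n
        exact (hgc.comp (by fun_prop : Continuous fun t : ℝ => t + n)).aestronglyMeasurable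
      · intro n
        refine Filter.Eventually.of_forall fun t ht => hbd n t ?_
        rw [Set.uIoc_of_le zero_le_one] at ht
        exact ⟨ht.1.le, ht.2⟩
      · exact Filter.Eventually.of_forall fun t _ => hsum
      · simp
      · refine Filter.Eventually.of_forall fun t ht => ?_
        rw [Set.uIoc_of_le zero_le_one] at ht
        exact (Summable.of_norm_bounded hsum fun n => hbd n t ⟨ht.1.le, ht.2⟩).hasSum
    rw [hS.unique hΦS]
    have hpt : ∀ t ∈ Set.Icc (0 : ℝ) 1, ∑' n : ℤ, ‖g n‖ ^ p ≤ C * Φ t := by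
      intro t ht
      have hPhi0 : 0 ≤ C * Φ t :=
        mul_nonneg hC.le (tsum_nonneg fun n => Real.rpow_nonneg (norm_nonneg _) _)
      refine Real.tsum_le_of_sum_le (fun n => Real.rpow_nonneg (norm_nonneg _) _) fun S => ?_
      have := h (g.compSubConstCLM ℂ (-t)) (hg (-t)) (-t)
        (by rw [abs_neg]; exact abs_le.2 ⟨by linarith [ht.1], ht.2⟩) S
      simp only [SchwartzMap.compSubConstCLM_apply, sub_neg_eq_add, neg_add_cancel_right] at this
      simpa only [hΦ, add_comm t] using this
    have hmono := intervalIntegral.integral_mono_on (a := (0 : ℝ)) (b := 1) (μ := volume)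
      (f := fun _ => ∑' n : ℤ, ‖g n‖ ^ p) (g := fun t => C * Φ t) zero_le_one (by simp)
      (ContinuousOn.intervalIntegrable (by
        rw [Set.uIcc_of_le zero_le_one]; exact continuousOn_const.mul hΦc)) hpt
    rw [intervalIntegral.integral_const_mul] at hmono
    simpa using hmono
  · refine hasSum_le_of_sum_le hS fun S => ?_
    have hii : ∀ n ∈ S, IntervalIntegrable (fun t : ℝ => ‖g (t + n)‖ ^ p) volume 0 1 := fun n _ =>
      (hgc.comp (by fun_prop : Continuous fun t : ℝ => t + (n : ℝ))).intervalIntegrable _ _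
    rw [← intervalIntegral.integral_finsetSum hii]
    have hcs : IntervalIntegrable (fun t : ℝ => ∑ n ∈ S, ‖g (t + n)‖ ^ p) volume 0 1 :=
      Continuous.intervalIntegrable (continuous_finset_sum S fun n _ =>
        hgc.comp (by fun_prop : Continuous fun t : ℝ => t + (n : ℝ))) _ _
    have hmono := intervalIntegral.integral_mono_on (a := (0 : ℝ)) (b := 1) (μ := volume)
      (f := fun t => ∑ n ∈ S, ‖g (t + n)‖ ^ p)
      (g := fun _ => C * ∑' n : ℤ, ‖g n‖ ^ p) zero_le_one
      hcs (by simp)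
      (fun t ht => by
        have := h g hg0 t (abs_le.2 ⟨by linarith [ht.1], ht.2⟩) S
        simpa only [add_comm t] using this)
    simpa using hmono

end PP

/-- Plancherel–Pólya: for `1 < p < ∞` there are constants `c, C > 0` depending only on
`p` such that for every `h > 0` and every Schwartz function `f` whose Fourier transform
`f̂(ξ) = ∫ f(x)e^{-ixξ}dx` is supported in `[-π/h, π/h]`,
`c · h ∑_n |f(hn)|^p ≤ ∫ |f|^p ≤ C · h ∑_n |f(hn)|^p`. -/
theorem plancherel_polya (p : ℝ) (hp1 : 1 < p) :
    ∃ c C : ℝ, 0 < c ∧ 0 < C ∧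
      ∀ (h : ℝ), 0 < h → ∀ f : SchwartzMap ℝ ℂ,
        (∀ ξ : ℝ, Real.pi / h < |ξ| →
          (∫ x : ℝ, f x * Complex.exp (-Complex.I * x * ξ)) = 0) →
        c * (h * ∑' n : ℤ, ‖f (h * n)‖ ^ p) ≤ (∫ x : ℝ, ‖f x‖ ^ p)
        ∧ (∫ x : ℝ, ‖f x‖ ^ p) ≤ C * (h * ∑' n : ℤ, ‖f (h * n)‖ ^ p) := by
  obtain ⟨C, hC, hu⟩ := PP.unit_case hp1
  refine ⟨1 / C, C, by positivity, hC, fun h hh f hf => ?_⟩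
  set e : ℝ ≃L[ℝ] ℝ := ContinuousLinearEquiv.unitsEquivAut ℝ (Units.mk0 h hh.ne')
  set g : SchwartzMap ℝ ℂ := SchwartzMap.compCLMOfContinuousLinearEquiv ℂ e f with hg
  have hgx : ∀ x, g x = f (h * x) := by
    intro x
    have : e x = h * x := by simp [e, mul_comm]
    rw [← this]; rfl
  have hband : ∀ t : ℝ, ∀ ξ : ℝ, 1 / 2 < |ξ| →
      FourierTransform.fourier (g.compSubConstCLM ℂ t) ξ = 0 := by
    intro t ξ hξ
    rw [SchwartzMap.fourier_coe, Real.fourier_eq']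
    set φ : ℝ → ℂ := fun y => f y * Complex.exp (-Complex.I * y * ((2 * Real.pi * ξ / h : ℝ) : ℂ))
      * Complex.exp (-(2 * Real.pi * t * ξ) * I) with hφ
    have e1 : ∀ x : ℝ, Complex.exp (((-2 * Real.pi * inner ℝ x ξ : ℝ) : ℂ) * I) •
        (g.compSubConstCLM ℂ t) x = φ (h * (x - t)) := by
      intro x
      rw [SchwartzMap.compSubConstCLM_apply, hgx, smul_eq_mul, mul_comm]
      simp only [hφ]
      rw [mul_assoc (f (h * (x - t))), ← Complex.exp_add]
      congr 2
      have hc : (h : ℂ) ≠ 0 := by exact_mod_cast hh.ne'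
      simp
      field_simp
      ring
    simp_rw [e1]
    rw [MeasureTheory.integral_sub_right_eq_self (fun x => φ (h * x)) t,
      MeasureTheory.Measure.integral_comp_mul_left, hφ, MeasureTheory.integral_mul_const, hf]
    · simp
    · rw [abs_div, abs_mul, abs_of_pos hh, abs_of_pos (by positivity : 0 < 2 * Real.pi)]
      gcongr
      nlinarith [Real.pi_pos]
  obtain ⟨h1, h2⟩ := hu g hband
  have hint : ∫ x : ℝ, ‖f x‖ ^ p = h * ∫ x : ℝ, ‖g x‖ ^ p := by
    simp_rw [hgx]
    rw [MeasureTheory.Measure.integral_comp_mul_left (fun y => ‖f y‖ ^ p), smul_eq_mul,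
      abs_of_pos (by positivity), mul_inv_cancel_left₀ hh.ne']
  simp_rw [hgx (_ : ℤ)] at h1 h2
  rw [hint]
  constructor
  · rw [one_div, inv_mul_le_iff₀ hC]
    nlinarith
  · nlinarith
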